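/- arXiv:1805.02228 — 3 statements merged into one kernel-verified Lean document; each statement's English description precedes it below -/
import Mathlib

section
/- If X is a regular Lindelöf topological space, then the tightness of the Gδ-modification X_δ of X satisfies t(X_δ) ≤ 2^{t(X)}. -/
open Cardinal Set

universe u

/-- The Gδ-modification of a topology: the topology generated by all Gδ sets. -/
def gDeltaModification {X : Type u} (t : TopologicalSpace X) : TopologicalSpace X :=
  TopologicalSpace.generateFrom {s : Set X | @IsGδ X t s}

/-- The tightness of a topological space: the smallest infinite cardinal `κ` such that
whenever a point `p` lies in the closure of a set `A`, there is `B ⊆ A` with `|B| ≤ κ`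
and `p` in the closure of `B`. -/
noncomputable def tightness (X : Type u) [TopologicalSpace X] : Cardinal.{u} :=
  sInf {κ : Cardinal.{u} | ℵ₀ ≤ κ ∧ ∀ (A : Set X) (p : X), p ∈ closure A →
    ∃ B ⊆ A, #B ≤ κ ∧ p ∈ closure B}

/-- The Gδ sets form a basis of the Gδ-modification. -/
theorem isTopologicalBasis_gDeltaModification {X : Type u} (t : TopologicalSpace X) :
    @TopologicalSpace.IsTopologicalBasis X (gDeltaModification t) {s : Set X | @IsGδ X t s} := by
  let := gDeltaModification t
  refine ⟨?_, ?_, rfl⟩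
  · intro s hs r hr x hx
    exact ⟨s ∩ r, @IsGδ.inter X t s r hs hr, hx, Subset.rfl⟩
  · exact eq_univ_of_univ_subset (subset_sUnion_of_mem (@IsGδ.univ X t))

theorem mem_closure_gDeltaModification_iff {X : Type u} [t : TopologicalSpace X] {A : Set X}
    {p : X} : p ∈ @closure X (gDeltaModification t) A ↔
      ∀ G : Set X, IsGδ G → p ∈ G → (G ∩ A).Nonempty :=
  @TopologicalSpace.IsTopologicalBasis.mem_closure_iff X (gDeltaModification t) _
    (isTopologicalBasis_gDeltaModification t) A p

/-- A point can be put in a set of size at most `2 ^ #I` closed under an `I`-ary operation. -/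
theorem exists_mem_mk_le_two_power_closed {X I : Type u} (hI : ℵ₀ ≤ #I) (F : (I → X) → X)
    (a : X) : ∃ S : Set X, #S ≤ 2 ^ #I ∧ a ∈ S ∧ ∀ f : I → X, (∀ i, f i ∈ S) → F f ∈ S := by
  let β : ULift.{u} Bool → Type u := fun b => cond b.down I PEmpty
  let ev : WType β → X := WType.elim X fun x => match x with
    | ⟨⟨false⟩, _⟩ => a
    | ⟨⟨true⟩, f⟩ => F f
  refine ⟨range ev, mk_range_le.trans (WType.cardinalMk_le_of_le ?_), ?_, ?_⟩
  · have h2 : ℵ₀ ≤ (2 : Cardinal.{u}) ^ #I := hI.trans (cantor _).le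
    have h3 : ((2 : Cardinal.{u}) ^ #I) ^ #I = 2 ^ #I := by
      rw [← power_mul, mul_eq_self hI]
    refine (sum_le_sum _ (fun _ => 2 ^ #I) ?_).trans ?_
    · rintro ⟨_ | _⟩
      · simpa [β] using one_le_aleph0.trans h2
      · exact h3.le
    · rw [sum_const', mk_uLift, mk_bool, lift_ofNat]
      exact (mul_eq_right h2 (ofNat_lt_aleph0.le.trans h2) two_ne_zero).le
  · exact ⟨WType.mk ⟨false⟩ PEmpty.elim, rfl⟩
  · intro f hf
    choose w hw using hf
    refine ⟨WType.mk ⟨true⟩ w, ?_⟩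
    change F (fun i => ev (w i)) = F f
    simp only [hw]

/-- A point outside a closed set has an open neighbourhood whose closure misses that set. -/
theorem exists_isOpen_disjoint_closure {X : Type u} [TopologicalSpace X] [RegularSpace X]
    {p : X} {C : Set X} (hC : IsClosed C) (hp : p ∉ C) :
    ∃ V, IsOpen V ∧ p ∈ V ∧ Disjoint (closure V) C := by
  obtain ⟨V, hV, hVo, hVC⟩ :=
    (TopologicalSpace.isTopologicalBasis_opens (α := X)).exists_closure_subset
      (hC.isOpen_compl.mem_nhds hp)
  exact ⟨V, hV, hVo, disjoint_left.2 fun x hx => hVC hx⟩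

/-- In a regular Lindelöf space in which closures are determined by subsets of size at most `κ`,
closures in the Gδ-modification are determined by subsets of size at most `2 ^ κ`. -/
theorem exists_subset_mk_le_two_power_mem_closure_gDelta {X : Type u} [t : TopologicalSpace X]
    [RegularSpace X] [LindelofSpace X] {κ : Cardinal.{u}} (hκ : ℵ₀ ≤ κ)
    (ht : ∀ (A : Set X) (p : X), p ∈ closure A → ∃ B ⊆ A, #B ≤ κ ∧ p ∈ closure B)
    {A : Set X} {p : X} (hp : p ∈ @closure X (gDeltaModification t) A) :
    ∃ B ⊆ A, #B ≤ 2 ^ κ ∧ p ∈ @closure X (gDeltaModification t) B := by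
  rw [mem_closure_gDeltaModification_iff] at hp
  simp only [mem_closure_gDeltaModification_iff]
  obtain ⟨a, -, ha⟩ := hp univ IsGδ.univ (mem_univ p)
  have hV : ∀ C : Set X, ∃ V, IsOpen V ∧ p ∈ V ∧
      (p ∉ closure C → Disjoint (closure V) (closure C)) := by
    intro C
    by_cases h : p ∈ closure C
    · exact ⟨univ, isOpen_univ, mem_univ p, fun h' => absurd h h'⟩
    · obtain ⟨V, h1, h2, h3⟩ := exists_isOpen_disjoint_closure isClosed_closure h
      exact ⟨V, h1, h2, fun _ => h3⟩
  choose V hVo hpV hVC using hV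
  have hF : ∀ f : (ℕ × ℕ) × κ.out → X, ∃ b ∈ A, ∀ n, b ∈ V (range fun k => f (n, k)) := by
    intro f
    obtain ⟨b, hb, hbA⟩ := hp (⋂ n, V (range fun k => f (n, k)))
      (.iInter_of_isOpen fun n => hVo _) (mem_iInter.2 fun n => hpV _)
    exact ⟨b, hbA, mem_iInter.1 hb⟩
  choose F hFA hFV using hF
  have hI : #((ℕ × ℕ) × κ.out) = κ := by
    simp [mk_prod, aleph0_mul_eq hκ]
  obtain ⟨S, hS, haS, hSF⟩ := exists_mem_mk_le_two_power_closed (hκ.trans hI.ge) F a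
  rw [hI] at hS
  refine ⟨S ∩ A, inter_subset_right, (mk_le_mk_of_subset inter_subset_left).trans hS, ?_⟩
  let B : Set X := S ∩ A
  have haB : a ∈ B := ⟨haS, ha⟩
  have key : ∀ U : Set X, IsOpen U → p ∈ U → ∃ g : ℕ → κ.out → B,
      ∀ b ∈ B, (∀ n, b ∈ V (range fun k => (g n k : X))) → b ∈ U := by
    intro U hU hpU
    have hL : IsLindelof (closure B \ U) := (isClosed_closure.sdiff hU).isLindelof
    obtain ⟨r, hr, hrc⟩ := hL.elim_countable_subcover
      (fun g : κ.out → B => (closure (V (range fun k => (g k : X))))ᶜ)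
      (fun g => isClosed_closure.isOpen_compl) (by
        rintro x ⟨hxB, hxU⟩
        obtain ⟨D, hDB, hDκ, hxD⟩ := ht B x hxB
        have hpx : p ∉ closure {x} := fun h => by
          obtain ⟨y, hyU, rfl⟩ := mem_closure_iff.1 h U hU hpU
          exact hxU hyU
        obtain ⟨W, hWo, hpW, hWx⟩ := exists_isOpen_disjoint_closure isClosed_closure hpx
        have hxW : x ∈ (closure W)ᶜ := fun h =>
          disjoint_left.1 hWx h (subset_closure rfl)
        let C := (closure W)ᶜ ∩ D
        have hxC : x ∈ closure C :=
          isClosed_closure.isOpen_compl.inter_closure ⟨hxW, hxD⟩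
        have hpC : p ∉ closure C := fun h => by
          obtain ⟨y, hyW, hyC⟩ := mem_closure_iff.1 h W hWo hpW
          exact hyC.1 (subset_closure hyW)
        obtain ⟨c, hc⟩ : C.Nonempty := closure_nonempty_iff.1 ⟨x, hxC⟩
        have hCκ : #C ≤ #κ.out := by
          rw [mk_out]
          exact (mk_le_mk_of_subset inter_subset_right).trans hDκ
        obtain ⟨e⟩ := hCκ
        have : Nonempty C := ⟨⟨c, hc⟩⟩
        let s : κ.out → C := Function.invFun e
        let g : κ.out → B := fun k => ⟨s k, hDB (s k).2.2⟩
        have hg : (range fun k => (g k : X)) = C := by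
          change range (Subtype.val ∘ s) = C
          rw [(Function.invFun_surjective e.injective).range_comp, Subtype.range_coe]
        refine mem_iUnion.2 ⟨g, fun h => ?_⟩
        rw [hg] at h
        exact disjoint_left.1 (hVC C hpC) h hxC)
    obtain ⟨g, hg⟩ := (hr.insert fun _ => ⟨a, haB⟩).exists_eq_range (insert_nonempty _ _)
    refine ⟨g, fun b hb hbV => by_contra fun hbU => ?_⟩
    obtain ⟨h, hhr, hbh⟩ := mem_iUnion₂.1 (hrc ⟨subset_closure hb, hbU⟩)
    obtain ⟨n, rfl⟩ : h ∈ range g := hg ▸ mem_insert_of_mem _ hhr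
    exact hbh (subset_closure (hbV n))
  intro G hG hpG
  obtain ⟨U, hUo, rfl⟩ := isGδ_iff_eq_iInter_nat.1 hG
  choose g hg using fun m => key (U m) (hUo m) (mem_iInter.1 hpG m)
  let f : (ℕ × ℕ) × κ.out → X := fun i => g i.1.1 i.1.2 i.2
  have hfB : F f ∈ B := ⟨hSF f fun i => (g i.1.1 i.1.2 i.2).2.1, hFA f⟩
  exact ⟨F f, mem_iInter.2 fun m => hg m _ hfB fun n => hFV f (m, n), hfB⟩

/-- If `X` is a regular Lindelöf space, then `t(X_δ) ≤ 2^{t(X)}`. -/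
theorem tightness_gDelta_le_of_regular_lindelof
    (X : Type u) [t : TopologicalSpace X] [T3Space X] [LindelofSpace X] :
    @tightness X (gDeltaModification t) ≤ 2 ^ tightness X := by
  have hne : {κ : Cardinal.{u} | ℵ₀ ≤ κ ∧ ∀ (A : Set X) (p : X), p ∈ closure A →
      ∃ B ⊆ A, #B ≤ κ ∧ p ∈ closure B}.Nonempty :=
    ⟨max ℵ₀ #X, le_max_left _ _, fun A p hp =>
      ⟨A, Subset.rfl, (mk_set_le A).trans (le_max_right _ _), hp⟩⟩
  obtain ⟨hκ, ht⟩ : ℵ₀ ≤ tightness X ∧ ∀ (A : Set X) (p : X), p ∈ closure A →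
      ∃ B ⊆ A, #B ≤ tightness X ∧ p ∈ closure B := csInf_mem hne
  exact csInf_le' ⟨hκ.trans (cantor _).le, fun A p hp =>
    exists_subset_mk_le_two_power_mem_closure_gDelta hκ ht hp⟩
end

section
/- If X is a compact Hausdorff topological space, then the tightness of the Gδ-modification X_δ of X satisfies t(X_δ) ≤ 2^{t(X)}. (This answers Question 2 of Bella and Spadaro affirmatively in the compact case.) -/
open Cardinal Set

universe u

/-- A point lies in a set of size at most `2 ^ #K` closed under a given `K`-ary operation. -/
theorem exists_closed_under_operation {Y K : Type u} [Infinite K] (F : (K → Y) → Y) (y : Y) :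
    ∃ B : Set Y, y ∈ B ∧ #B ≤ 2 ^ #K ∧ ∀ f : K → Y, (∀ k, f k ∈ B) → F f ∈ B := by
  let β : Option PUnit.{u + 1} → Type u := fun o => o.elim PEmpty fun _ => K
  let e : (Σ a, β a → Y) → Y := fun x =>
    match x with
    | ⟨none, _⟩ => y
    | ⟨some _, f⟩ => F f
  let ev : WType β → Y := WType.elim Y e
  have hcard : #(WType β) ≤ 2 ^ #K := by
    apply WType.cardinalMk_le_of_le'
    have hK : ℵ₀ ≤ #K := aleph0_le_mk K
    have hle : ∀ o, (2 ^ #K : Cardinal.{u}) ^ #(β o) ≤ 2 ^ #K := by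
      rintro (_ | _)
      · simpa [β] using (one_le_two.trans (self_le_power 2 (one_le_aleph0.trans hK)))
      · simp [β, ← power_mul, mul_eq_self hK]
    simp only [lift_id]
    refine (Cardinal.sum_le_sum _ _ hle).trans ?_
    rw [Cardinal.sum_const']
    exact mul_le_of_le (hK.trans (cantor _).le)
      ((lt_aleph0_of_finite _).le.trans (hK.trans (cantor _).le)) le_rfl
  refine ⟨range ev, ⟨WType.mk none PEmpty.elim, rfl⟩, mk_range_le.trans hcard, fun f hf => ?_⟩
  choose g hg using hf
  refine ⟨WType.mk (some PUnit.unit) g, ?_⟩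
  exact congrArg F (funext hg)

theorem tightness_spec (X : Type u) [TopologicalSpace X] :
    ℵ₀ ≤ tightness X ∧ ∀ (A : Set X) (p : X), p ∈ closure A →
      ∃ B ⊆ A, #B ≤ tightness X ∧ p ∈ closure B := by
  refine csInf_mem (s := {κ : Cardinal.{u} | ℵ₀ ≤ κ ∧ ∀ (A : Set X) (p : X), p ∈ closure A →
    ∃ B ⊆ A, #B ≤ κ ∧ p ∈ closure B}) ⟨max ℵ₀ #X, le_max_left _ _, fun A p hp => ?_⟩
  exact ⟨A, Subset.rfl, (mk_set_le A).trans (le_max_right _ _), hp⟩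

/-- In a space of tightness at most `#K`, points in a closure are in the closure of a
`K`-indexed family. -/
theorem exists_range_subset_mem_closure {X K : Type u} [TopologicalSpace X]
    (hK : #K = tightness X) {A : Set X} {p : X} (hp : p ∈ closure A) :
    ∃ f : K → X, range f ⊆ A ∧ p ∈ closure (range f) := by
  obtain ⟨C, hCA, hC, hpC⟩ := (tightness_spec X).2 A p hp
  obtain ⟨c, hc⟩ : C.Nonempty := closure_nonempty_iff.1 ⟨p, hpC⟩
  obtain ⟨i⟩ : Nonempty (C ↪ K) := by rwa [← hK] at hC
  have : Nonempty C := ⟨⟨c, hc⟩⟩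
  have hs := Function.invFun_surjective i.injective
  have hr : range (fun k => (Function.invFun i k).val) = C := by
    rw [range_comp' Subtype.val, hs.range_eq, image_univ, Subtype.range_coe]
  exact ⟨_, hr.subset.trans hCA, by rwa [hr]⟩

/-- In a regular space a point and the closures of the sets avoiding it can be
simultaneously separated by open sets. -/
theorem exists_separating_nhds {X : Type u} [TopologicalSpace X] [RegularSpace X] (p : X) :
    ∃ U V : Set X → Set X, (∀ C, IsOpen (U C) ∧ p ∈ U C) ∧
      ∀ C, p ∉ closure C → IsOpen (V C) ∧ closure C ⊆ V C ∧ Disjoint (U C) (V C) := by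
  have h : ∀ C : Set X, ∃ UV : Set X × Set X, (IsOpen UV.1 ∧ p ∈ UV.1) ∧
      (p ∉ closure C → IsOpen UV.2 ∧ closure C ⊆ UV.2 ∧ Disjoint UV.1 UV.2) := by
    intro C
    by_cases hC : p ∈ closure C
    · exact ⟨(univ, univ), ⟨isOpen_univ, mem_univ p⟩, fun h => (h hC).elim⟩
    · obtain ⟨V, U, hV, hU, hCV, hpU, hd⟩ : SeparatedNhds (closure C) {p} := by
        rw [separatedNhds_iff_disjoint, nhdsSet_singleton]
        exact RegularSpace.regular isClosed_closure hC
      rw [singleton_subset_iff] at hpU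
      exact ⟨(U, V), ⟨hU, hpU⟩, fun _ => ⟨hV, hCV, hd.symm⟩⟩
  choose UV h₁ h₂ using h
  exact ⟨fun C => (UV C).1, fun C => (UV C).2, h₁, h₂⟩

/-- If `X` is a compact Hausdorff space, then `t(X_δ) ≤ 2^{t(X)}`. -/
theorem tightness_gDelta_le_of_compact_t2
    (X : Type u) [t : TopologicalSpace X] [CompactSpace X] [T2Space X] :
    @tightness X (gDeltaModification t) ≤ 2 ^ tightness X := by
  have hκ := (tightness_spec X).1
  refine csInf_le' ⟨hκ.trans (cantor _).le, fun A p hp => ?_⟩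
  rw [mem_closure_gDeltaModification_iff] at hp
  obtain ⟨K, hK⟩ : ∃ K : Type u, #K = tightness X := ⟨_, mk_out _⟩
  have : Infinite K := infinite_iff.2 (hK ▸ hκ)
  obtain ⟨U, V, hU, hV⟩ := exists_separating_nhds p
  have hF : ∀ f : ℕ × K → X, ∃ a ∈ A, ∀ n, a ∈ U (range fun k => f (n, k)) := by
    intro f
    obtain ⟨a, haU, haA⟩ := hp (⋂ n, U (range fun k => f (n, k)))
      (.iInter_of_isOpen fun n => (hU _).1) (mem_iInter.2 fun n => (hU _).2)
    exact ⟨a, haA, mem_iInter.1 haU⟩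
  choose F hFA hFU using hF
  obtain ⟨a₀, -, ha₀⟩ := hp univ .univ (mem_univ p)
  obtain ⟨B, ha₀B, hB, hBF⟩ := exists_closed_under_operation F a₀
  refine ⟨B ∩ A, inter_subset_right, ?_, mem_closure_gDeltaModification_iff.2 fun G hG hpG => ?_⟩
  · refine (mk_le_mk_of_subset inter_subset_left).trans (hB.trans_eq ?_)
    rw [mk_prod, lift_id', mk_nat, lift_aleph0, hK, aleph0_mul_eq hκ]
  obtain ⟨O, hO, rfl⟩ := hG.eq_iInter_nat
  rw [mem_iInter] at hpG
  have hpO : ∀ n, p ∉ closure (B \ O n) := fun n h =>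
    closure_minimal (fun x hx => hx.2) (hO n).isClosed_compl h (hpG n)
  have hg : ∀ n q, ∃ g : K → X, q ∈ closure (B \ O n) →
      range g ⊆ B \ O n ∧ q ∈ closure (range g) := by
    intro n q
    by_cases hq : q ∈ closure (B \ O n)
    · obtain ⟨g, hg⟩ := exists_range_subset_mem_closure hK hq
      exact ⟨g, fun _ => hg⟩
    · exact ⟨fun _ => q, fun h => (hq h).elim⟩
  choose g hg using hg
  have hV' : ∀ n, ∀ q ∈ closure (B \ O n), IsOpen (V (range (g n q))) ∧
      closure (range (g n q)) ⊆ V (range (g n q)) ∧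
      Disjoint (U (range (g n q))) (V (range (g n q))) := fun n q hq =>
    hV _ fun h => hpO n (closure_mono (hg n q hq).1 h)
  have hcover : ∀ n, ∃ T : Finset X, (∀ q ∈ T, q ∈ closure (B \ O n)) ∧
      closure (B \ O n) ⊆ ⋃ q ∈ T, V (range (g n q)) := fun n =>
    isClosed_closure.isCompact.elim_nhds_subcover _ fun q hq =>
      (hV' n q hq).1.mem_nhds ((hV' n q hq).2.1 (hg n q hq).2)
  choose T hT hTcover using hcover
  let S : Set (K → X) := insert (fun _ => a₀) (⋃ n, g n '' (T n : Set X))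
  have hS : S.Countable :=
    (countable_iUnion fun n => ((T n).countable_toSet.image (g n))).insert _
  obtain ⟨f, hf⟩ := hS.exists_eq_range (insert_nonempty _ _)
  have hSB : ∀ h ∈ S, ∀ k, h k ∈ B := by
    rintro h (rfl | hh) k
    · exact ha₀B
    · obtain ⟨n, q, hq, rfl⟩ := mem_iUnion.1 hh
      exact ((hg n q (hT n q hq)).1 (mem_range_self k)).1
  let a := F fun x => f x.1 x.2
  have haB : a ∈ B := hBF _ fun x => hSB _ (hf ▸ mem_range_self x.1) x.2
  refine ⟨a, mem_iInter.2 fun n => ?_, haB, hFA _⟩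
  by_contra haO
  obtain ⟨q, hq, haV⟩ := mem_iUnion₂.1 (hTcover n (subset_closure ⟨haB, haO⟩))
  obtain ⟨m, hm⟩ : g n q ∈ range f :=
    hf ▸ mem_insert_of_mem _ (mem_iUnion.2 ⟨n, q, hq, rfl⟩)
  have haU : a ∈ U (range (g n q)) := hm ▸ hFU (fun x => f x.1 x.2) m
  exact (hV' n q (hT n q hq)).2.2.le_bot ⟨haU, haV⟩
end

section
/- Let λ be an uncountable cardinal, let X be a topological space with t(p, X) < λ for every p ∈ X, let A ⊆ X and p ∈ X, and suppose that for every B ⊆ A with |B| < λ the point p is not in the closure of B in the Gδ-modification X_δ. If there exists a λ-complete fine free ultrafilter 𝒰 on [A]^{<λ}, then p is not in the closure of A in X_δ. -/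
open Cardinal Set

universe u

/-- The tightness of a space at a point `p`: the smallest infinite cardinal `κ` such
that whenever `p` lies in the closure of a set `A`, there is `B ⊆ A` with `|B| ≤ κ`
and `p` in the closure of `B`. -/
noncomputable def pointTightness {X : Type u} [TopologicalSpace X] (p : X) : Cardinal.{u} :=
  sInf {κ : Cardinal.{u} | ℵ₀ ≤ κ ∧ ∀ A : Set X, p ∈ closure A →
    ∃ B ⊆ A, #B ≤ κ ∧ p ∈ closure B}

/-- An ultrafilter is `λ`-complete if it is closed under intersections of fewer than
`λ` of its members. -/
def IsLambdaComplete {α : Type u} (U : Ultrafilter α) (l : Cardinal.{u}) : Prop :=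
  ∀ s : Set (Set α), #s < l → (∀ v ∈ s, v ∈ U) → ⋂₀ s ∈ U

/-- Every neighbourhood in the Gδ-modification contains a Gδ set of the original topology. -/
theorem exists_isGδ_of_isOpen_gDeltaModification {X : Type u} [t : TopologicalSpace X]
    {s : Set X} (hs : @IsOpen X (gDeltaModification t) s) {p : X} (hp : p ∈ s) :
    ∃ G : Set X, IsGδ G ∧ p ∈ G ∧ G ⊆ s := by
  change TopologicalSpace.GenerateOpen {s : Set X | IsGδ s} s at hs
  induction hs with
  | basic s hs => exact ⟨s, hs, hp, Subset.rfl⟩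
  | univ => exact ⟨univ, IsGδ.univ, hp, Subset.rfl⟩
  | inter s₁ s₂ _ _ ih₁ ih₂ =>
    obtain ⟨G₁, hG₁, hp₁, hs₁⟩ := ih₁ hp.1
    obtain ⟨G₂, hG₂, hp₂, hs₂⟩ := ih₂ hp.2
    exact ⟨G₁ ∩ G₂, hG₁.inter hG₂, ⟨hp₁, hp₂⟩, inter_subset_inter hs₁ hs₂⟩
  | sUnion S _ ih =>
    obtain ⟨s, hs, hps⟩ := hp
    obtain ⟨G, hG, hpG, hGs⟩ := ih s hs hps
    exact ⟨G, hG, hpG, hGs.trans (subset_sUnion_of_mem hs)⟩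

/-- A point is outside the Gδ-closure of `B` iff some sequence of open neighbourhoods of the
point has intersection disjoint from `B`. -/
theorem not_mem_closure_gDeltaModification_iff {X : Type u} [t : TopologicalSpace X]
    {B : Set X} {p : X} :
    p ∉ @closure X (gDeltaModification t) B ↔
      ∃ V : ℕ → Set X, (∀ n, IsOpen (V n)) ∧ (∀ n, p ∈ V n) ∧ ∀ b ∈ B, ∃ n, b ∉ V n := by
  rw [@mem_closure_iff X (gDeltaModification t)]
  constructor
  · intro h
    push Not at h
    obtain ⟨s, hs, hp, hsB⟩ := h
    obtain ⟨G, hG, hpG, hGs⟩ := exists_isGδ_of_isOpen_gDeltaModification hs hp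
    obtain ⟨V, hV, rfl⟩ := isGδ_iff_eq_iInter_nat.1 hG
    refine ⟨V, hV, mem_iInter.1 hpG, fun b hb => ?_⟩
    by_contra! hbV
    exact (hsB ▸ ⟨hGs (mem_iInter.2 hbV), hb⟩ : b ∈ (∅ : Set X))
  · rintro ⟨V, hV, hp, hVB⟩ h
    have hG : @IsOpen X (gDeltaModification t) (⋂ n, V n) :=
      TopologicalSpace.GenerateOpen.basic _ (IsGδ.iInter_of_isOpen hV)
    obtain ⟨b, hbV, hb⟩ := h _ hG (mem_iInter.2 hp)
    obtain ⟨n, hn⟩ := hVB b hb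
    exact hn (mem_iInter.1 hbV n)

/-- The tightness at a point is attained. -/
theorem exists_subset_card_le_pointTightness {X : Type u} [TopologicalSpace X] {p : X}
    {A : Set X} (hp : p ∈ closure A) :
    ∃ B ⊆ A, #B ≤ pointTightness p ∧ p ∈ closure B := by
  have hne : {κ : Cardinal.{u} | ℵ₀ ≤ κ ∧ ∀ A : Set X, p ∈ closure A →
      ∃ B ⊆ A, #B ≤ κ ∧ p ∈ closure B}.Nonempty :=
    ⟨max ℵ₀ #X, le_max_left _ _, fun A hA =>
      ⟨A, Subset.rfl, (mk_set_le A).trans (le_max_right _ _), hA⟩⟩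
  exact (csInf_mem hne).2 A hp

theorem IsLambdaComplete.iInter_mem {α ι : Type u} {U : Ultrafilter α} {l : Cardinal.{u}}
    (hU : IsLambdaComplete U l) (hι : #ι < l) {s : ι → Set α} (hs : ∀ i, s i ∈ U) :
    ⋂ i, s i ∈ U := by
  rw [← sInter_range]
  exact hU _ (mk_range_le.trans_lt hι) (forall_mem_range.2 hs)

theorem IsLambdaComplete.exists_mem_of_iUnion_nat {α : Type u} {U : Ultrafilter α}
    {l : Cardinal.{u}} (hU : IsLambdaComplete U l) (hl : ℵ₀ < l) {s : ℕ → Set α}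
    (hs : ⋃ n, s n ∈ U) : ∃ n, s n ∈ U := by
  by_contra! h
  refine Ultrafilter.compl_mem_iff_notMem.1 ?_ hs
  rw [compl_iUnion, ← sInter_range]
  exact hU _ ((countable_range _).le_aleph0.trans_lt hl)
    (forall_mem_range.2 fun n => Ultrafilter.compl_mem_iff_notMem.2 (h n))

/-- Let `λ` be an uncountable cardinal and `X` a space with `t(p, X) < λ` at every
point. Suppose `A ⊆ X` and `p ∈ X` are such that `p` is not in the `X_δ`-closure of
any `B ⊆ A` with `|B| < λ`. If there is a `λ`-complete fine free ultrafilter on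
`[A]^{<λ}`, then `p` is not in the `X_δ`-closure of `A`. -/
theorem not_mem_gDelta_closure_of_ultrafilter
    (l : Cardinal.{u}) (hl : Cardinal.aleph0 < l)
    (X : Type u) [t : TopologicalSpace X]
    (ht : ∀ p : X, pointTightness p < l)
    (A : Set X) (p : X)
    (hB : ∀ B ⊆ A, #B < l → p ∉ @closure X (gDeltaModification t) B)
    (hU : ∃ U : Ultrafilter {B : Set X // B ⊆ A ∧ #B < l},
      IsLambdaComplete U l ∧
      (∀ a ∈ A, {B : {B : Set X // B ⊆ A ∧ #B < l} | a ∈ B.1} ∈ U) ∧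
      (∀ B₀ : {B : Set X // B ⊆ A ∧ #B < l},
        ({B₀} : Set {B : Set X // B ⊆ A ∧ #B < l}) ∉ U)) :
    p ∉ @closure X (gDeltaModification t) A := by
  obtain ⟨U, hc, hfine, -⟩ := hU
  have hsep := fun B : {B : Set X // B ⊆ A ∧ #B < l} =>
    not_mem_closure_gDeltaModification_iff.1 (hB B.1 B.2.1 B.2.2)
  choose V hVo hVp hVB using hsep
  have hA : ∀ a ∈ A, ∃ n, {B | a ∉ V B n} ∈ U := fun a ha => by
    refine hc.exists_mem_of_iUnion_nat hl (Filter.mem_of_superset (hfine a ha) ?_)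
    exact fun B haB => mem_iUnion.2 (hVB B a haB)
  refine not_mem_closure_gDeltaModification_iff.2
    ⟨fun n => (closure {a | {B | a ∉ V B n} ∈ U})ᶜ, fun n => isClosed_closure.isOpen_compl,
      fun n hp => ?_, fun a ha => ?_⟩
  · obtain ⟨C, hCA, hC, hpC⟩ := exists_subset_card_le_pointTightness hp
    obtain ⟨B, hBC⟩ := U.nonempty_of_mem
      (hc.iInter_mem (hC.trans_lt (ht p)) fun c : C => hCA c.2)
    obtain ⟨c, hcV, hcC⟩ := mem_closure_iff.1 hpC _ (hVo B n) (hVp B n)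
    exact mem_iInter.1 hBC ⟨c, hcC⟩ hcV
  · obtain ⟨n, hn⟩ := hA a ha
    exact ⟨n, not_not_intro (subset_closure hn)⟩
end
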